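/- Let F be a field and let B be an invertible N×N matrix over F. Then B^∨B is similar to its inverse (B^∨B)⁻¹ = B⁻¹Bᵀ; that is, there exists an invertible N×N matrix U over F with U(B^∨B)U⁻¹ = (B^∨B)⁻¹. In particular the characteristic polynomials of B^∨B and of (B^∨B)⁻¹ coincide, so the set of eigenvalues of B^∨B is invariant under λ ↦ λ⁻¹. -/

import Mathlib

open Polynomial in
/-- A nonzero quotient of `K[X]` carries a linear functional whose kernel contains no nonzero
ideal; equivalently, it is a Frobenius algebra. -/
theorem Polynomial.exists_quotient_functional_mul_ne_zero {K : Type*} [Field K]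
    {I : Ideal K[X]} (hI : I ≠ ⊥) :
    ∃ φ : (K[X] ⧸ I) →ₗ[K] K, ∀ a ≠ 0, ∃ c, φ (a * c) ≠ 0 := by
  obtain ⟨g, hg, rfl⟩ : ∃ g : K[X], g.Monic ∧ I = Ideal.span {g} := by
    obtain ⟨q, rfl⟩ := IsPrincipalIdealRing.principal I
    have hq : q ≠ 0 := by
      rintro rfl
      simp at hI
    exact ⟨q * C q.leadingCoeff⁻¹, monic_mul_leadingCoeff_inv hq,
      (Ideal.span_singleton_mul_right_unit (by simpa using hq) q).symm⟩
  let φ : AdjoinRoot g →ₗ[K] K :=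
    (lcoeff K (g.natDegree - 1)).comp (AdjoinRoot.modByMonicHom hg)
  refine ⟨φ, fun (a : AdjoinRoot g) ha ↦ ?_⟩
  set r := AdjoinRoot.modByMonicHom hg a
  have hr : AdjoinRoot.mk g r = a := AdjoinRoot.mk_leftInverse hg a
  have hr0 : r ≠ 0 := by
    intro h
    exact ha (by rw [← hr, h]; exact map_zero (AdjoinRoot.mk g))
  have hdeg : r.degree < g.degree := by
    obtain ⟨f, hf⟩ := AdjoinRoot.mk_surjective a
    have : r = f %ₘ g := by rw [← AdjoinRoot.modByMonicHom_mk hg, hf]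
    rw [this]
    exact degree_modByMonic_lt f hg
  have hnat : r.natDegree < g.natDegree := natDegree_lt_natDegree hr0 hdeg
  refine ⟨AdjoinRoot.mk g (X ^ (g.natDegree - 1 - r.natDegree)), ?_⟩
  have hlt : (r * X ^ (g.natDegree - 1 - r.natDegree)).degree < g.degree := by
    apply degree_lt_degree
    rw [natDegree_mul_X_pow _ hr0]
    omega
  change φ (a * _) ≠ 0
  rw [← hr, ← map_mul]
  change (AdjoinRoot.modByMonicHom hg (AdjoinRoot.mk g _)).coeff (g.natDegree - 1) ≠ 0
  rw [AdjoinRoot.modByMonicHom_mk, (modByMonic_eq_self_iff hg).mpr hlt]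
  obtain ⟨k, hk⟩ := Nat.exists_eq_add_of_le (Nat.le_sub_one_of_lt hnat)
  rw [hk, Nat.add_sub_cancel_left, coeff_mul_X_pow]
  simpa using hr0

open Polynomial in
/-- A finitely generated torsion module over `K[X]` carries a nondegenerate bilinear form for
which multiplication by `X` is self-adjoint. -/
theorem Polynomial.exists_separatingLeft_X_smul_selfAdjoint {K M : Type*} [Field K]
    [AddCommGroup M] [Module K M] [Module K[X] M] [IsScalarTower K K[X] M]
    [Module.Finite K[X] M] (hM : Module.IsTorsion K[X] M) :
    ∃ β : M →ₗ[K] M →ₗ[K] K, β.SeparatingLeft ∧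
      ∀ v w, β ((X : K[X]) • v) w = β v ((X : K[X]) • w) := by
  classical
  obtain ⟨ι, _, p, hp, n, ⟨e₀⟩⟩ := Module.equiv_directSum_of_isTorsion hM
  let e : M ≃ₗ[K[X]] ((i : ι) → K[X] ⧸ Ideal.span {p i ^ n i}) :=
    e₀.trans (DirectSum.linearEquivFunOnFintype K[X] ι _)
  have he (k : K) (v : M) : e (k • v) = k • e v := by
    rw [← algebraMap_smul K[X] k v, map_smul]
    ext i
    exact algebraMap_smul K[X] k (e v i)
  have hI (i : ι) : Ideal.span {p i ^ n i} ≠ ⊥ := by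
    simpa using fun h ↦ absurd h (hp i).ne_zero
  choose φ hφ using fun i ↦ exists_quotient_functional_mul_ne_zero (hI i)
  refine ⟨LinearMap.mk₂ K (fun v w ↦ ∑ i, φ i (e v i * e w i)) ?_ ?_ ?_ ?_, ?_, ?_⟩
  · simp [add_mul, Finset.sum_add_distrib]
  · intro k v w
    simp only [he, Pi.smul_apply, Finset.smul_sum]
    exact Finset.sum_congr rfl fun i _ ↦ (congrArg (φ i)
      (smul_mul_assoc k (e v i) (e w i))).trans ((φ i).map_smul k _)
  · simp [mul_add, Finset.sum_add_distrib]
  · intro k v w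
    simp only [he, Pi.smul_apply, Finset.smul_sum]
    exact Finset.sum_congr rfl fun i _ ↦ (congrArg (φ i)
      (mul_smul_comm k (e v i) (e w i))).trans ((φ i).map_smul k _)
  · intro v hv
    by_contra hv0
    obtain ⟨i, hi⟩ := Function.ne_iff.mp (e.map_ne_zero_iff.mpr hv0)
    obtain ⟨c, hc⟩ := hφ i _ hi
    refine hc ?_
    have h := hv (e.symm (Pi.single i c))
    rw [LinearMap.mk₂_apply, e.apply_symm_apply,
      Finset.sum_eq_single i (fun j _ hj ↦ by simp [hj]) (by simp)] at h
    simpa using h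
  · intro v w
    simp only [LinearMap.mk₂_apply, map_smul, Pi.smul_apply]
    exact Finset.sum_congr rfl fun i _ ↦ congrArg (φ i)
      ((smul_mul_assoc X (e v i) (e w i)).trans (mul_smul_comm X (e v i) (e w i)).symm)

/-- Every square matrix over a field is similar to its transpose. -/
theorem Matrix.exists_isUnit_det_mul_eq_transpose_mul {K n : Type*} [Field K] [Fintype n]
    [DecidableEq n] (A : Matrix n n K) :
    ∃ S : Matrix n n K, IsUnit S.det ∧ S * A = A.transpose * S := by
  let f := Matrix.toLin' A
  obtain ⟨β, hβ, hX⟩ := Polynomial.exists_separatingLeft_X_smul_selfAdjoint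
    (Module.AEval.isTorsion_of_finiteDimensional K (n → K) f)
  let γ : (n → K) →ₗ[K] (n → K) →ₗ[K] K :=
    β.compl₁₂ (Module.AEval'.of f).toLinearMap (Module.AEval'.of f).toLinearMap
  have hγ : γ.SeparatingLeft := fun v hv ↦ by
    refine (Module.AEval'.of f).map_eq_zero_iff.mp (hβ _ fun w ↦ ?_)
    simpa [γ] using hv ((Module.AEval'.of f).symm w)
  have hadj : LinearMap.IsAdjointPair γ γ f f := fun v w ↦ by
    simpa [γ, ← Module.AEval'.X_smul_of] using hX (Module.AEval'.of f v) (Module.AEval'.of f w)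
  refine ⟨LinearMap.toMatrix₂' K γ, ?_, ?_⟩
  · rw [isUnit_iff_ne_zero, ← Matrix.separatingLeft_iff_det_ne_zero]
    exact LinearMap.BilinForm.separatingLeft_toMatrix'_iff.mpr hγ
  · rw [← Matrix.toLinearMap₂'_toMatrix' (R := K) γ] at hadj
    exact ((isAdjointPair_toLinearMap₂' _ _ A A).mp hadj).symm

/-- **Key observation in the proof of Lemma 4.5 of "Geometric non-vanishing"
(Ulmer).** Let `F` be a field and `B` an invertible `N × N` matrix over `F`.
Writing `B^∨ = (Bᵀ)⁻¹` for the inverse transpose, one has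
`(B^∨ B)⁻¹ = B⁻¹ Bᵀ`, the matrix `B^∨ B` is similar to its inverse, and in
particular the characteristic polynomials of `B^∨ B` and `(B^∨ B)⁻¹`
coincide (so the eigenvalues of `B^∨ B` are invariant under `λ ↦ λ⁻¹`). -/
theorem invTranspose_mul_self_similar_inverse
    {F : Type*} [Field F] {N : ℕ}
    (B : Matrix (Fin N) (Fin N) F) (hB : IsUnit B.det) :
    (B.transpose⁻¹ * B)⁻¹ = B⁻¹ * B.transpose ∧
    (∃ U : Matrix (Fin N) (Fin N) F, IsUnit U.det ∧
        U * (B.transpose⁻¹ * B) * U⁻¹ = (B.transpose⁻¹ * B)⁻¹) ∧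
    (B.transpose⁻¹ * B).charpoly = ((B.transpose⁻¹ * B)⁻¹).charpoly := by
  have hBt : IsUnit B.transpose.det := by rwa [Matrix.det_transpose]
  have hinv : (B.transpose⁻¹ * B)⁻¹ = B⁻¹ * B.transpose := by
    rw [Matrix.mul_inv_rev, Matrix.nonsing_inv_nonsing_inv _ hBt]
  obtain ⟨S, hS, hSA⟩ := Matrix.exists_isUnit_det_mul_eq_transpose_mul (B.transpose⁻¹ * B)
  have hT : (B.transpose⁻¹ * B).transpose = B.transpose * B⁻¹ := by
    rw [Matrix.transpose_mul, Matrix.transpose_nonsing_inv, Matrix.transpose_transpose]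
  have hU : IsUnit (B⁻¹ * S).det := by
    rw [Matrix.det_mul]
    exact (B.isUnit_nonsing_inv_det hB).mul hS
  have hsim : (B⁻¹ * S) * (B.transpose⁻¹ * B) * (B⁻¹ * S)⁻¹ = (B.transpose⁻¹ * B)⁻¹ := by
    have h : (B⁻¹ * S) * (B.transpose⁻¹ * B) = B⁻¹ * B.transpose * (B⁻¹ * S) := by
      rw [Matrix.mul_assoc, hSA, hT]
      simp only [Matrix.mul_assoc]
    rw [h, Matrix.mul_nonsing_inv_cancel_right _ _ hU, hinv]
  refine ⟨hinv, ⟨B⁻¹ * S, hU, hsim⟩, ?_⟩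
  rw [← hsim]
  have := Matrix.charpoly_units_conj (Matrix.nonsingInvUnit _ hU) (B.transpose⁻¹ * B)
  exact this.symm
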